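/- arXiv:1702.05004 — 2 statements merged into one kernel-verified Lean document; each statement's English description precedes it below -/
import Mathlib

section
/- Let $n \geq 1$ and let $T = \{(t_1,\ldots,t_n) \in \mathbb{R}^n : t_1 > t_2 > \cdots > t_n > 1\}$. For a complex number $z$ with sufficiently large real part, the integral $\gamma_n(z) = \int_T \left(\prod_{1 \le i < j \le n}(t_i^2 - t_j^2)\right)\left(\prod_{j=1}^n t_j\right)^{-z-n} dt_1\cdots dt_n$ converges and equals $\prod_{m=1}^{n}(m-1)!\prod_{j=1}^m \frac{1}{z-m-1+2j}$. -/
open MeasureTheory Finset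

/-- The partial fraction identity for `∏ j, (x + s j) / (x - s j)` at infinity. -/
theorem sum_mul_prod_add_div_sub {K ι : Type*} [Field K] [NeZero (2 : K)] [Fintype ι]
    [DecidableEq ι] {s : ι → K} (hs : Function.Injective s) :
    ∑ k, s k * ∏ j ∈ univ.erase k, (s k + s j) / (s k - s j) = ∑ k, s k := by
  rcases isEmpty_or_nonempty ι with h | h
  · simp
  have hpos : 0 < #(univ : Finset ι) := card_pos.2 univ_nonempty
  set Q : Polynomial K := ∏ j, (Polynomial.X - Polynomial.C (s j)) with hQ
  set R : Polynomial K := ∏ j, (Polynomial.X - Polynomial.C (-s j)) with hR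
  have hQm : Q.Monic := Polynomial.monic_prod_X_sub_C _ _
  have hRm : R.Monic := Polynomial.monic_prod_X_sub_C _ _
  have hQd : Q.degree = #(univ : Finset ι) := by simp [hQ, Polynomial.degree_prod]
  have hRd : R.degree = #(univ : Finset ι) := by simp [hR, Polynomial.degree_prod]
  have hlt : (R - Q).degree < #(univ : Finset ι) := by
    rw [← hRd]
    exact Polynomial.degree_sub_lt_left (hRd.trans hQd.symm) hRm.ne_zero
      (hRm.leadingCoeff.trans hQm.leadingCoeff.symm)
  have h := Lagrange.coeff_eq_sum (hs.injOn (s := ((univ : Finset ι) : Set ι))) hlt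
  rw [Polynomial.coeff_sub, hR, hQ, Polynomial.prod_X_sub_C_coeff_card_pred _ _ hpos,
    Polynomial.prod_X_sub_C_coeff_card_pred _ _ hpos] at h
  have h2 : (2 : K) ≠ 0 := NeZero.ne 2
  apply mul_left_cancel₀ h2
  rw [mul_sum]
  trans -∑ i, -s i - -∑ i, s i
  · rw [h]
    refine sum_congr rfl fun k _ => ?_
    rw [prod_div_distrib, ← mul_div_assoc, ← mul_div_assoc]
    congr 1
    have hQ0 : ∏ j, (s k - s j) = 0 := prod_eq_zero (mem_univ k) (sub_self _)
    simp only [Polynomial.eval_sub, Polynomial.eval_prod, Polynomial.eval_X, Polynomial.eval_C,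
      hQ0, sub_neg_eq_add, sub_zero]
    rw [← mul_prod_erase _ _ (mem_univ k)]
    ring
  · rw [sum_neg_distrib]
    ring

theorem prod_prod_Ioi_succAbove {R : Type*} [CommRing R] {n : ℕ}
    {f : Fin (n + 1) → Fin (n + 1) → R} (hf : ∀ i j, f i j = -f j i) (k : Fin (n + 1)) :
    ∏ i, ∏ j ∈ Ioi i, f i j = (-1) ^ (k : ℕ) * (∏ j, f k (k.succAbove j)) *
      ∏ i, ∏ j ∈ Ioi i, f (k.succAbove i) (k.succAbove j) := by
  have h := Equiv.Perm.prod_Ioi_comp_eq_sign_mul_prod k.cycleRange.symm hf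
  rw [Fin.prod_univ_succ] at h
  simp only [Fin.prod_Ioi_zero, Fin.prod_Ioi_succ, Fin.cycleRange_symm_zero,
    Fin.cycleRange_symm_succ, Equiv.Perm.sign_symm, Fin.sign_cycleRange] at h
  rw [mul_assoc, h]
  push_cast
  rw [← mul_assoc, ← pow_add, ← two_mul, pow_mul]
  simp

/-- The value of the ordered integral of `det (t i ^ (-s j - 1))` over `t 0 > t 1 > ⋯ > 1`;
the double product is Schur's Pfaffian. -/
noncomputable def schurProd {n : ℕ} (s : Fin n → ℂ) : ℂ :=
  (∏ i, (s i)⁻¹) * ∏ i, ∏ j ∈ Ioi i, (s j - s i) / (s j + s i)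

theorem schurProd_succ {n : ℕ} {s : Fin (n + 1) → ℂ} (hs : Function.Injective s)
    (hre : ∀ i, 0 < (s i).re) :
    ∑ k : Fin (n + 1), (-1) ^ (n + (k : ℕ)) * schurProd (fun j => s (k.succAbove j)) =
      (∑ k, s k) * schurProd s := by
  have hne : ∀ i, s i ≠ 0 := fun i h => by simpa [h] using hre i
  have hadd : ∀ i j, s i + s j ≠ 0 := fun i j h => by
    have := congrArg Complex.re h
    simp only [Complex.add_re, Complex.zero_re] at this
    linarith [hre i, hre j]
  rw [← sum_mul_prod_add_div_sub hs, sum_mul]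
  refine sum_congr rfl fun k _ => ?_
  have hsub : ∀ j, s k - s (k.succAbove j) ≠ 0 := fun j =>
    sub_ne_zero.2 fun h => (Fin.succAbove_ne k j) (hs h).symm
  rw [schurProd, schurProd, prod_prod_Ioi_succAbove (f := fun i j => (s j - s i) / (s j + s i))
    (fun i j => by rw [← neg_div, neg_sub, add_comm]) k, Fin.prod_univ_succAbove _ k]
  have herase : ∏ j ∈ univ.erase k, (s k + s j) / (s k - s j) =
      ∏ j, (s k + s (k.succAbove j)) / (s k - s (k.succAbove j)) := by
    rw [← compl_singleton, ← Fin.image_succAbove_univ,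
      prod_image fun _ _ _ _ h => Fin.succAbove_right_injective h]
  have hcancel : (∏ j, (s k + s (k.succAbove j)) / (s k - s (k.succAbove j))) *
      ∏ j, (s (k.succAbove j) - s k) / (s (k.succAbove j) + s k) = (-1) ^ n := by
    rw [← prod_mul_distrib]
    trans ∏ _j : Fin n, (-1 : ℂ)
    · refine prod_congr rfl fun j _ => ?_
      have h1 := hsub j
      have h2 := hadd k (k.succAbove j)
      rw [add_comm (s (k.succAbove j)), ← neg_sub (s k)]
      field_simp
    · simp
  rw [herase, pow_add, ← hcancel]
  have := hne k
  field_simp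

/-- The region `t 0 > t 1 > ⋯ > t (n - 1) > a`. -/
def orderedRegion (n : ℕ) (a : ℝ) : Set (Fin n → ℝ) :=
  {t | (∀ i j : Fin n, i < j → t j < t i) ∧ ∀ i, a < t i}

/-- The matrix with entries `t i ^ (-s j - 1)`. -/
noncomputable def powMatrix {n : ℕ} (s : Fin n → ℂ) (t : Fin n → ℝ) : Matrix (Fin n) (Fin n) ℂ :=
  .of fun i j => (t i : ℂ) ^ (-s j - 1)

theorem snoc_mem_orderedRegion {n : ℕ} {a y : ℝ} {t : Fin n → ℝ} :
    (Fin.snoc t y : Fin (n + 1) → ℝ) ∈ orderedRegion (n + 1) a ↔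
      a < y ∧ t ∈ orderedRegion n y := by
  constructor
  · rintro ⟨h1, h2⟩
    exact ⟨by simpa using h2 (Fin.last n),
      fun i j hij => by simpa using h1 _ _ (Fin.castSucc_lt_castSucc_iff.2 hij),
      fun i => by simpa using h1 _ _ (Fin.castSucc_lt_last i)⟩
  · rintro ⟨h2, h, h3⟩
    refine ⟨fun i j hij => ?_,
      Fin.forall_fin_succ'.2 ⟨fun i => by simpa using h2.trans (h3 i), by simpa using h2⟩⟩
    induction i using Fin.lastCases with
    | last => exact absurd hij (Fin.le_last j).not_gt
    | cast i =>
      induction j using Fin.lastCases with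
      | last => simpa using h3 i
      | cast j => simpa using h i j (Fin.castSucc_lt_castSucc_iff.1 hij)

theorem measurableSet_orderedRegion_uncurry (n : ℕ) :
    MeasurableSet {p : ℝ × (Fin n → ℝ) | p.2 ∈ orderedRegion n p.1} := by
  change MeasurableSet {p : ℝ × (Fin n → ℝ) |
    (∀ i j : Fin n, i < j → p.2 j < p.2 i) ∧ ∀ i, p.1 < p.2 i}
  measurability

theorem measurableSet_orderedRegion (n : ℕ) (a : ℝ) : MeasurableSet (orderedRegion n a) :=
  (measurableSet_orderedRegion_uncurry n).preimage (measurable_prodMk_left (x := a))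

theorem integrableOn_det_powMatrix {n : ℕ} {s : Fin n → ℂ} (hre : ∀ i, 0 < (s i).re) {a : ℝ}
    (ha : 0 < a) : IntegrableOn (fun t => (powMatrix s t).det) (orderedRegion n a) := by
  have hsub : orderedRegion n a ⊆ Set.univ.pi fun _ => Set.Ioi a := fun t ht i _ => ht.2 i
  refine IntegrableOn.mono_set ?_ hsub
  simp only [Matrix.det_apply]
  refine integrable_finsetSum _ fun σ _ => Integrable.smul _ ?_
  rw [volume_pi, Measure.restrict_pi_pi]
  have hperm : (fun t : Fin n → ℝ => ∏ i, powMatrix s t (σ i) i) =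
      fun t => ∏ i, (t i : ℂ) ^ (-s (σ.symm i) - 1) := by
    ext t
    exact Fintype.prod_equiv σ _ _ fun i => by simp [powMatrix]
  rw [hperm]
  refine Integrable.fintype_prod (f := fun i (x : ℝ) => (x : ℂ) ^ (-s (σ.symm i) - 1)) fun i => ?_
  exact integrableOn_Ioi_cpow_of_lt (by
    rw [Complex.sub_re, Complex.neg_re, Complex.one_re]
    linarith [hre (σ.symm i)]) ha

theorem setIntegral_orderedRegion_succ {n : ℕ} {a : ℝ} {f : (Fin (n + 1) → ℝ) → ℂ}
    (hf : IntegrableOn f (orderedRegion (n + 1) a)) :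
    ∫ t in orderedRegion (n + 1) a, f t =
      ∫ y in Set.Ioi a, ∫ t in orderedRegion n y, f (Fin.snoc t y) := by
  have he := (volume_preserving_piFinSuccAbove (fun _ : Fin (n + 1) => ℝ) (Fin.last n)).symm
  rw [← integrable_indicator_iff (measurableSet_orderedRegion _ _)] at hf
  have hf' := (he.integrable_comp_emb (MeasurableEquiv.measurableEmbedding _)).2 hf
  rw [← integral_indicator (measurableSet_orderedRegion _ _), ← he.integral_comp',
    Measure.volume_eq_prod]
  rw [Measure.volume_eq_prod] at hf'
  refine (integral_prod _ hf').trans ?_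
  rw [← integral_indicator measurableSet_Ioi]
  have hsnoc : ∀ y t, (MeasurableEquiv.piFinSuccAbove (fun _ : Fin (n + 1) => ℝ)
      (Fin.last n)).symm (y, t) = (Fin.snoc t y : Fin (n + 1) → ℝ) := fun y t =>
    Fin.insertNth_last' y t
  congr 1 with y
  by_cases hy : y ∈ Set.Ioi a
  · rw [Set.indicator_of_mem hy, ← integral_indicator (measurableSet_orderedRegion _ _)]
    congr 1 with t
    classical
    rw [Function.comp_apply, hsnoc, Set.indicator_apply, Set.indicator_apply]
    exact if_congr (snoc_mem_orderedRegion.trans (and_iff_right hy)) rfl rfl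
  · rw [Set.indicator_of_notMem hy]
    refine (integral_congr_ae (.of_forall fun t => ?_)).trans (integral_zero _ _)
    rw [Function.comp_apply, hsnoc]
    exact Set.indicator_of_notMem (fun h => hy (snoc_mem_orderedRegion.1 h).1) _

theorem det_powMatrix_snoc {n : ℕ} (s : Fin (n + 1) → ℂ) (t : Fin n → ℝ) (y : ℝ) :
    (powMatrix s (Fin.snoc t y : Fin (n + 1) → ℝ)).det = ∑ k : Fin (n + 1),
      (-1) ^ (n + (k : ℕ)) * (y : ℂ) ^ (-s k - 1) *
        (powMatrix (fun j => s (k.succAbove j)) t).det := by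
  rw [Matrix.det_succ_row _ (Fin.last n)]
  refine sum_congr rfl fun k _ => ?_
  simp only [powMatrix, Matrix.of_apply, Fin.snoc_last, Fin.val_last]
  congr 2
  ext i j
  simp [Fin.succAbove_last]

theorem setIntegral_det_powMatrix {n : ℕ} {s : Fin n → ℂ} (hs : Function.Injective s)
    (hre : ∀ i, 0 < (s i).re) {a : ℝ} (ha : 0 < a) :
    ∫ t in orderedRegion n a, (powMatrix s t).det =
      (a : ℂ) ^ (-∑ i, s i) * schurProd s := by
  induction n generalizing a with
  | zero =>
    have : orderedRegion 0 a = Set.univ := Set.eq_univ_of_forall fun t => ⟨nofun, nofun⟩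
    simp [this, schurProd, volume_pi, integral_unique, measureReal_def]
  | succ n ih =>
    rw [setIntegral_orderedRegion_succ (integrableOn_det_powMatrix hre ha)]
    have hS : 0 < (∑ i, s i).re := by
      rw [Complex.re_sum]
      exact sum_pos (fun i _ => hre i) univ_nonempty
    have hS0 : ∑ i, s i ≠ 0 := fun h => by simp [h] at hS
    have inner : ∀ y ∈ Set.Ioi a,
        ∫ t in orderedRegion n y, (powMatrix s (Fin.snoc t y : Fin (n + 1) → ℝ)).det =
          (y : ℂ) ^ (-∑ i, s i - 1) * ((∑ i, s i) * schurProd s) := by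
      intro y hy
      have hy0 : 0 < y := ha.trans hy
      simp only [det_powMatrix_snoc]
      rw [integral_finsetSum _ fun k _ =>
        (integrableOn_det_powMatrix (fun j => hre (k.succAbove j)) hy0).const_mul _,
        ← schurProd_succ hs hre, mul_sum]
      refine sum_congr rfl fun k _ => ?_
      rw [integral_const_mul, ih (s := fun j => s (k.succAbove j)) (hs.comp Fin.succAbove_right_injective)
        (fun j => hre (k.succAbove j)) hy0, Fin.sum_univ_succAbove _ k,
        show -(s k + ∑ j, s (k.succAbove j)) - 1 = (-s k - 1) + -∑ j, s (k.succAbove j) by ring,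
        Complex.cpow_add _ _ (by exact_mod_cast hy0.ne')]
      ring
    rw [setIntegral_congr_fun measurableSet_Ioi inner, integral_mul_const,
      integral_Ioi_cpow_of_lt (by rw [Complex.sub_re, Complex.neg_re, Complex.one_re]; linarith) ha]
    simp only [sub_add_cancel]
    field_simp

theorem det_powMatrix_arith {n : ℕ} (z : ℂ) {t : Fin n → ℝ} (ht : ∀ i, 0 < t i) :
    (powMatrix (fun j => z - n + 1 + 2 * ((j : ℕ) : ℂ)) t).det =
      ((∏ i : Fin n, ∏ j ∈ Finset.Ioi i, ((t i) ^ 2 - (t j) ^ 2) : ℝ) : ℂ) *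
          ((∏ j : Fin n, t j : ℝ) : ℂ) ^ (-z - (n : ℂ)) := by
  have hprod : ((∏ j : Fin n, t j : ℝ) : ℂ) ^ (-z - (n : ℂ)) =
      ∏ j, (t j : ℂ) ^ (-z - (n : ℂ)) := by
    have key : ∀ u : Finset (Fin n), ((∏ j ∈ u, t j : ℝ) : ℂ) ^ (-z - (n : ℂ)) =
        ∏ j ∈ u, (t j : ℂ) ^ (-z - (n : ℂ)) := by
      intro u
      induction u using Finset.induction_on with
      | empty => simp
      | insert i u hi ih =>
        rw [prod_insert hi, prod_insert hi, ← ih, Complex.ofReal_mul,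
          Complex.mul_cpow_ofReal_nonneg (ht i).le (prod_nonneg fun j _ => (ht j).le)]
    exact key univ
  have hdet := Matrix.det_projVandermonde (fun _ => 1) fun i => (t i : ℂ) ^ 2
  simp only [one_mul] at hdet
  rw [hprod]
  push_cast
  rw [← hdet, mul_comm, ← Matrix.det_mul_column]
  congr 1
  ext i j
  have hne : (t i : ℂ) ≠ 0 := by exact_mod_cast (ht i).ne'
  simp only [powMatrix, Matrix.of_apply, Matrix.projVandermonde_apply, one_pow, one_mul]
  rw [← pow_mul, ← Complex.cpow_natCast, ← Complex.cpow_add _ _ hne]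
  congr 1
  have hj : (j : ℕ) + 1 ≤ n := j.2
  rw [Fin.val_rev]
  push_cast [Nat.cast_sub hj]
  ring

theorem prod_prod_Ioi_eq_prod_range {M : Type*} [CommMonoid M] (n : ℕ) (f : ℕ → ℕ → M) :
    ∏ i : Fin n, ∏ j ∈ Ioi i, f i j = ∏ j ∈ range n, ∏ i ∈ range j, f i j := by
  rw [← Fin.prod_univ_eq_prod_range fun j => ∏ i ∈ range j, f i j]
  trans ∏ j : Fin n, ∏ i ∈ Iio j, f i j
  · exact prod_comm' (by simp)
  · refine prod_congr rfl fun j _ => ?_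
    rw [← Nat.Iio_eq_range, ← Fin.map_valEmbedding_Iio, prod_map]
    rfl

theorem prod_range_sub_eq_factorial (j : ℕ) :
    ∏ i ∈ range j, ((j : ℂ) - i) = j.factorial := by
  rw [← prod_range_add_one_eq_factorial, ← prod_range_reflect]
  push_cast
  refine prod_congr rfl fun i hi => ?_
  have : i + 1 ≤ j := mem_range.1 hi
  rw [Nat.sub_sub, add_comm 1 i]
  push_cast [Nat.cast_sub this]
  ring

theorem prod_range_inv_eq_prod_Icc (n : ℕ) (z : ℂ) :
    (∏ j ∈ range n, (z - n + 1 + 2 * (j : ℂ))⁻¹) *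
        ∏ j ∈ range n, ∏ i ∈ range j, (z - n + 1 + i + j)⁻¹ =
      ∏ m ∈ Icc 1 n, ∏ j ∈ Icc 1 m, 1 / (z - m - 1 + 2 * (j : ℂ)) := by
  induction n with
  | zero => simp
  | succ n ih =>
    rw [prod_Icc_succ_top (by omega), ← ih, mul_comm]
    congr 1
    · rw [prod_range_succ', range_zero, prod_empty, mul_one, ← prod_mul_distrib]
      refine prod_congr rfl fun j _ => ?_
      rw [prod_range_succ, mul_comm]
      congr 1
      · push_cast
        ring
      · refine prod_congr rfl fun i _ => ?_
        push_cast
        ring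
    · rw [← Finset.Ico_add_one_right_eq_Icc, prod_Ico_eq_prod_range]
      refine prod_congr (by simp) fun j _ => ?_
      rw [one_div]
      push_cast
      ring

theorem schurProd_arith {n : ℕ} (z : ℂ) :
    schurProd (fun j : Fin n => z - n + 1 + 2 * ((j : ℕ) : ℂ)) = ∏ m ∈ Finset.Icc 1 n,
          ((Nat.factorial (m - 1) : ℂ) *
            ∏ j ∈ Finset.Icc 1 m, 1 / (z - (m : ℂ) - 1 + 2 * (j : ℂ))) := by
  have hfac : ∏ m ∈ Icc 1 n, (Nat.factorial (m - 1) : ℂ) =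
      ∏ j ∈ range n, ∏ i ∈ range j, ((j : ℂ) - i) := by
    simp only [prod_range_sub_eq_factorial]
    rw [← Finset.Ico_add_one_right_eq_Icc, prod_Ico_eq_prod_range]
    simp
  rw [prod_mul_distrib, ← prod_range_inv_eq_prod_Icc, hfac, mul_left_comm, schurProd,
    Fin.prod_univ_eq_prod_range (fun j => (z - n + 1 + 2 * (j : ℂ))⁻¹)]
  congr 1
  rw [prod_prod_Ioi_eq_prod_range n (fun i j => (z - n + 1 + 2 * (j : ℂ) -
    (z - n + 1 + 2 * (i : ℂ))) / (z - n + 1 + 2 * (j : ℂ) + (z - n + 1 + 2 * (i : ℂ)))),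
    ← prod_mul_distrib]
  refine prod_congr rfl fun j _ => ?_
  rw [← prod_mul_distrib]
  refine prod_congr rfl fun i _ => ?_
  rw [← div_eq_mul_inv, ← mul_div_mul_left ((j : ℂ) - i) _ (two_ne_zero' ℂ)]
  congr 1 <;> ring

/-- The Selberg-type integral `γ_n(z)` from the paper: convergence and evaluation. -/
theorem stmt_0 (n : ℕ) (hn : 1 ≤ n) (z : ℂ) (hz : 2 * (n : ℝ) - 1 < z.re) :
    IntegrableOn
      (fun t : Fin n → ℝ =>
        ((∏ i : Fin n, ∏ j ∈ Finset.Ioi i, ((t i) ^ 2 - (t j) ^ 2) : ℝ) : ℂ) *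
          ((∏ j : Fin n, t j : ℝ) : ℂ) ^ (-z - (n : ℂ)))
      {t : Fin n → ℝ | (∀ i j : Fin n, i < j → t j < t i) ∧ ∀ i, 1 < t i}
      volume ∧
    (∫ t in {t : Fin n → ℝ | (∀ i j : Fin n, i < j → t j < t i) ∧ ∀ i, 1 < t i},
        ((∏ i : Fin n, ∏ j ∈ Finset.Ioi i, ((t i) ^ 2 - (t j) ^ 2) : ℝ) : ℂ) *
          ((∏ j : Fin n, t j : ℝ) : ℂ) ^ (-z - (n : ℂ)))
      = ∏ m ∈ Finset.Icc 1 n,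
          ((Nat.factorial (m - 1) : ℂ) *
            ∏ j ∈ Finset.Icc 1 m, 1 / (z - (m : ℂ) - 1 + 2 * (j : ℂ))) := by
  set s : Fin n → ℂ := fun j => z - n + 1 + 2 * ((j : ℕ) : ℂ) with hs
  have hinj : Function.Injective s := fun i j h => by simpa [hs, Fin.ext_iff] using h
  have hre : ∀ j, 0 < (s j).re := fun j => by
    have hn' : (1 : ℝ) ≤ n := by exact_mod_cast hn
    have hj : (0 : ℝ) ≤ (j : ℕ) := Nat.cast_nonneg _
    simp only [hs, Complex.add_re, Complex.sub_re, Complex.natCast_re, Complex.one_re,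
      Complex.mul_re, Complex.re_ofNat, Complex.im_ofNat, zero_mul, sub_zero]
    linarith
  have hEq : Set.EqOn (fun t => (powMatrix s t).det) (fun t : Fin n → ℝ =>
        ((∏ i : Fin n, ∏ j ∈ Finset.Ioi i, ((t i) ^ 2 - (t j) ^ 2) : ℝ) : ℂ) *
          ((∏ j : Fin n, t j : ℝ) : ℂ) ^ (-z - (n : ℂ))) (orderedRegion n 1) := fun t ht =>
    det_powMatrix_arith z fun i => one_pos.trans (ht.2 i)
  constructor
  · exact (integrableOn_det_powMatrix hre one_pos).congr_fun hEq (measurableSet_orderedRegion n 1)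
  · rw [← schurProd_arith]
    refine (setIntegral_congr_fun (measurableSet_orderedRegion n 1) hEq).symm.trans ?_
    rw [setIntegral_det_powMatrix hinj hre one_pos]
    simp [hs]
end

section
/- Let $\lambda = \ell_1 e_1 + \cdots + \ell_n e_n$ with integers $\ell_1 > \cdots > \ell_n > 0$ such that $\ell_j - \ell_{j-1}$ is odd for all $2 \le j \le n$. Define, for a weight $\mathbf{m} = (\ell_1 + 1 + m)(e_1 + \cdots + e_n)$ with $m \geq 0$ even, the Blattner-type sum $\mathrm{mult}_\lambda(\mathbf{m}) = \sum_{\sigma \in S_n} \varepsilon(\sigma)\, Q\Big(\sum_{j=1}^n (\ell_1 + 1 + m - \ell_j) e_j - \sigma\big(\sum_{j=1}^n j\, e_j\big)\Big)$, where $Q(\mu)$ counts the number of ways to write $\mu \in \mathbb{Z}^n$ as a sum (with multiplicity) of the vectors $e_i + e_j$, $1 \le i \le j \le n$, and $\varepsilon$ is the sign character. Then $\mathrm{mult}_\lambda(\mathbf{m}) = 1$. -/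
open Finset

/-- The Kostant-type partition function `Q(μ)`: the number of ways to write `μ ∈ ℤⁿ` as a
sum with multiplicities of the vectors `eᵢ + eⱼ`, `i ≤ j`. -/
noncomputable def Qpart (n : ℕ) (μ : Fin n → ℤ) : ℕ :=
  Set.ncard {c : {p : Fin n × Fin n // p.1 ≤ p.2} → ℕ |
    ∀ x : Fin n,
      (∑ p : {p : Fin n × Fin n // p.1 ≤ p.2},
        (c p : ℤ) * ((if p.1.1 = x then 1 else 0) + (if p.1.2 = x then 1 else 0))) = μ x}

section KernelAlgebra
variable {R S : Type*} [CommRing R] [CommRing S]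

/-- The product of `1 - vᵢ vⱼ` over all `i ≤ j`. -/
def symDenom {k : ℕ} (v : Fin k → R) : R :=
  ∏ p : {p : Fin k × Fin k // p.1 ≤ p.2}, (1 - v p.1.1 * v p.1.2)

/-- The quotient of the Vandermonde determinant of `v` by `∏ (1 - vᵢ vⱼ)` over `i ≤ j`. -/
def altKernel [Inv R] {k : ℕ} (v : Fin k → R) : R :=
  (Matrix.vandermonde v).det * (symDenom v)⁻¹

theorem symDenom_eq_prod_sym2 {k : ℕ} (v : Fin k → R) :
    symDenom v = ∏ s : Sym2 (Fin k), (1 - (s.map v).mul) :=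
  (Fintype.prod_equiv Sym2.sortEquiv _ _ (Sym2.ind fun a b => by
    rcases le_total a b with h | h <;> simp [Sym2.mul, h, mul_comm])).symm

theorem symDenom_comp_perm {k : ℕ} (v : Fin k → R) (σ : Equiv.Perm (Fin k)) :
    symDenom (v ∘ σ) = symDenom v := by
  rw [symDenom_eq_prod_sym2, symDenom_eq_prod_sym2]
  refine Fintype.prod_bijective (Sym2.map σ)
    (Finite.injective_iff_bijective.1 (Sym2.map.injective σ.injective)) _ _ fun s => ?_
  rw [Sym2.map_map]

theorem altKernel_comp_perm [Inv R] {k : ℕ} (v : Fin k → R) (σ : Equiv.Perm (Fin k)) :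
    altKernel (v ∘ σ) = ((Equiv.Perm.sign σ : ℤ) : R) * altKernel v := by
  rw [altKernel, altKernel, symDenom_comp_perm, ← mul_assoc, ← Matrix.det_permute]
  rfl

theorem symDenom_succ {k : ℕ} (v : Fin (k + 1) → R) :
    symDenom v = symDenom (v ∘ Fin.castSucc) *
      ((∏ i : Fin k, (1 - v i.castSucc * v (Fin.last k))) * (1 - v (Fin.last k) ^ 2)) := by
  have key : ∀ (m : ℕ) (w : Fin m → R),
      symDenom w = ∏ j : Fin m, ∏ i ∈ Iic j, (1 - w i * w j) := by
    intro m w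
    rw [symDenom, ← Finset.prod_subtype
      (univ.filter fun p : Fin m × Fin m => p.1 ≤ p.2) (by simp)
      (fun p : Fin m × Fin m => 1 - w p.1 * w p.2)]
    rw [Finset.prod_filter, Fintype.prod_prod_type, Finset.prod_comm]
    refine Finset.prod_congr rfl fun j _ => ?_
    rw [← Finset.prod_filter]
    exact Finset.prod_congr (by ext; simp) fun _ _ => rfl
  rw [key, key, Fin.prod_univ_castSucc]
  congr 1
  · refine Finset.prod_congr rfl fun j _ => ?_
    rw [← Fin.map_castSuccEmb_Iic, Finset.prod_map]
    rfl
  · have : Iic (Fin.last k) = univ := by ext; simp [Fin.le_last]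
    rw [this, Fin.prod_univ_castSucc, sq]

theorem det_vandermonde_castSucc {k : ℕ} (v : Fin (k + 1) → R) :
    (Matrix.vandermonde v).det = (Matrix.vandermonde (v ∘ Fin.castSucc)).det *
      ∏ i : Fin k, (v (Fin.last k) - v i.castSucc) := by
  have key : ∀ (m : ℕ) (w : Fin m → R),
      (Matrix.vandermonde w).det = ∏ j : Fin m, ∏ i ∈ Iio j, (w j - w i) := by
    intro m w
    rw [Matrix.det_vandermonde]
    exact Finset.prod_comm' (by simp)
  rw [key, key, Fin.prod_univ_castSucc]
  congr 1
  · refine Finset.prod_congr rfl fun j _ => ?_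
    rw [← Fin.map_castSuccEmb_Iio, Finset.prod_map]
    rfl
  · rw [Fin.Iio_last_eq_map, Finset.prod_map]
    rfl

theorem map_altKernel [Inv R] [Inv S] {k : ℕ} (f : R →+* S) (v : Fin k → R)
    (h : symDenom v * (symDenom v)⁻¹ = 1)
    (hf : symDenom (f ∘ v) * (symDenom (f ∘ v))⁻¹ = 1) :
    f (altKernel v) = altKernel (f ∘ v) := by
  have hd : f (symDenom v) = symDenom (f ∘ v) := by simp [symDenom, map_prod]
  have hi : f (symDenom v)⁻¹ = (symDenom (f ∘ v))⁻¹ := by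
    have := congrArg f h
    rw [map_mul, map_one, hd] at this
    calc f (symDenom v)⁻¹ = f (symDenom v)⁻¹ * (symDenom (f ∘ v) * (symDenom (f ∘ v))⁻¹) := by
          rw [hf, mul_one]
      _ = (symDenom (f ∘ v) * f (symDenom v)⁻¹) * (symDenom (f ∘ v))⁻¹ := by ring
      _ = _ := by rw [this, one_mul]
  rw [altKernel, altKernel, map_mul, hi, RingHom.map_det]
  congr 2
  ext i j
  simp [Matrix.vandermonde]

end KernelAlgebra

section PartialFractions
variable {K : Type*} [Field K]

theorem prod_div_eq_partial_fractions {ι : Type*} [Fintype ι] [DecidableEq ι] (v : ι → K) (t : K)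
    (hv : Function.Injective v) (ht : t ≠ 0) (h : ∀ i, 1 - v i * t ≠ 0) :
    ∏ i, ((t - v i) / (1 - v i * t)) = ∏ i, (-v i) +
      ∑ j, t / (1 - v j * t) * ((1 - v j ^ 2) *
        ∏ i ∈ univ.erase j, ((1 - v i * v j) / (v j - v i))) := by
  let w : Option ι → K := fun o => o.elim t⁻¹ v
  have hw : Set.InjOn w (univ : Finset (Option ι)) := by
    have h0 : ∀ i, v i ≠ t⁻¹ := fun i hi => h i (by rw [hi]; field_simp; ring)
    rintro (_ | a) _ (_ | b) _ hab
    · rfl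
    · exact absurd hab.symm (h0 b)
    · exact absurd hab (h0 a)
    · exact congrArg some (hv hab)
  let P : Polynomial K := ∏ i, (Polynomial.C (-v i) * Polynomial.X + Polynomial.C 1)
  have hPn : P.natDegree ≤ Fintype.card ι := by
    refine (Polynomial.natDegree_prod_le _ _).trans ?_
    refine (Finset.sum_le_sum fun i _ => Polynomial.natDegree_linear_le).trans ?_
    simp
  have hPc : P.coeff (Fintype.card ι) = ∏ i, (-v i) := by
    have := Polynomial.coeff_prod_of_natDegree_le (univ : Finset ι)
      (fun i => Polynomial.C (-v i) * Polynomial.X + Polynomial.C 1) 1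
      (fun i _ => Polynomial.natDegree_linear_le)
    rw [mul_one, Finset.card_univ] at this
    rw [this]
    exact Finset.prod_congr rfl fun i _ => by
      rw [Polynomial.coeff_add, Polynomial.coeff_C_mul, Polynomial.coeff_X_one, mul_one,
        Polynomial.coeff_C_succ, add_zero]
  have hP : P.degree < #(univ : Finset (Option ι)) := by
    refine lt_of_le_of_lt Polynomial.degree_le_natDegree ?_
    rw [Finset.card_univ, Fintype.card_option]
    exact_mod_cast Nat.lt_succ_of_le hPn
  have hPe : ∀ x, P.eval x = ∏ i, (1 - v i * x) := by
    intro x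
    simp only [P, Polynomial.eval_prod]
    exact Finset.prod_congr rfl fun i _ => by simp; ring
  have key := Lagrange.coeff_eq_sum hw hP
  rw [Finset.card_univ, Fintype.card_option, Nat.add_sub_cancel, hPc, Fintype.sum_option] at key
  have e1 : (univ : Finset (Option ι)).erase none = univ.map Function.Embedding.some := by
    ext x; cases x <;> simp
  have e2 : ∀ j : ι, (univ : Finset (Option ι)).erase (some j) = insertNone (univ.erase j) := by
    intro j; ext x; cases x <;> simp
  rw [e1, Finset.prod_map, hPe, ← Finset.prod_div_distrib] at key
  simp only [e2, Finset.prod_insertNone, hPe] at key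
  rw [key, add_assoc, ← Finset.sum_add_distrib, Finset.sum_eq_zero, add_zero]
  · refine Finset.prod_congr rfl fun i _ => ?_
    simp only [w, Option.elim, Function.Embedding.some_apply]
    have : t⁻¹ - v i ≠ 0 := by
      intro h'
      apply h i
      field_simp at h'
      linear_combination h'
    have h3 : 1 - t * v i ≠ 0 := by rw [mul_comm]; exact h i
    field_simp
  · intro j _
    have h1 := h j
    have h2 : v j - t⁻¹ = -(1 - v j * t) / t := by field_simp; ring
    simp only [w, Option.elim]
    rw [h2, ← Finset.mul_prod_erase univ _ (mem_univ j), Finset.prod_div_distrib]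
    have h3 : ∏ i ∈ univ.erase j, (v j - v i) ≠ 0 :=
      Finset.prod_ne_zero_iff.2 fun i hi =>
        sub_ne_zero.2 fun hji => (Finset.ne_of_mem_erase hi) (hv hji.symm)
    field_simp
    ring

theorem altKernel_succ {k : ℕ} (v : Fin (k + 1) → K) :
    altKernel v = altKernel (v ∘ Fin.castSucc) *
      ((∏ i : Fin k, ((v (Fin.last k) - v i.castSucc) / (1 - v i.castSucc * v (Fin.last k)))) *
        (1 - v (Fin.last k) ^ 2)⁻¹) := by
  rw [altKernel, altKernel, symDenom_succ, det_vandermonde_castSucc, Finset.prod_div_distrib]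
  simp only [mul_inv, div_eq_mul_inv]
  ring

theorem altKernel_recurrence_field {k : ℕ} (v : Fin (k + 2) → K) (hv : Function.Injective v)
    (ht : v (Fin.last _) ≠ 0) (h : ∀ i j, 1 - v i * v j ≠ 0) :
    (1 - v (Fin.last _) ^ 2) * altKernel v =
      (∏ i : Fin (k + 1), (-v i.castSucc)) * altKernel (v ∘ Fin.castSucc) +
      ∑ j : Fin (k + 1), ((Equiv.Perm.sign (Equiv.swap j (Fin.last k)) : ℤ) : K) *
        (v (Fin.last _) * (1 - v j.castSucc * v (Fin.last _))⁻¹ *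
          altKernel (v ∘ Fin.castSucc ∘ Equiv.swap j (Fin.last k) ∘ Fin.castSucc)) := by
  have hs : 1 - v (Fin.last _) ^ 2 ≠ 0 := by rw [sq]; exact h _ _
  rw [altKernel_succ, prod_div_eq_partial_fractions (fun i : Fin (k + 1) => v i.castSucc) _
    (hv.comp (Fin.castSucc_injective _)) ht fun i => h _ _]
  rw [mul_comm _ (1 - v (Fin.last _) ^ 2)⁻¹, mul_left_comm, mul_inv_cancel_left₀ hs, mul_add,
    mul_comm (altKernel _), add_right_inj, Finset.mul_sum]
  refine Finset.sum_congr rfl fun j _ => ?_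
  set x : Fin (k + 1) → K := v ∘ Fin.castSucc with hx
  set τ := Equiv.swap j (Fin.last k)
  have h1 : altKernel x = ((Equiv.Perm.sign τ : ℤ) : K) * altKernel (x ∘ τ) := by
    rw [altKernel_comp_perm, ← mul_assoc, ← Int.cast_mul, ← Units.val_mul, Int.units_mul_self]
    simp
  have h2 : ∀ f : Fin (k + 1) → K, ∏ i ∈ univ.erase j, f i = ∏ i : Fin k, f (τ i.castSucc) := by
    intro f
    have : univ.erase j = (univ : Finset (Fin k)).map (Fin.castSuccEmb.trans τ.toEmbedding) := by
      ext i
      simp only [mem_erase, mem_univ, and_true, mem_map, true_and, Function.Embedding.trans_apply,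
        Fin.coe_castSuccEmb, Equiv.coe_toEmbedding]
      constructor
      · intro hi
        obtain ⟨a, ha⟩ := Fin.exists_castSucc_eq.2 (show τ i ≠ Fin.last k from fun h => hi (by
          rw [← τ.injective.eq_iff, h, Equiv.swap_apply_left]))
        exact ⟨a, by rw [ha, Equiv.swap_apply_self]⟩
      · rintro ⟨a, rfl⟩ h
        have : a.castSucc = Fin.last k := by
          rw [← τ.injective.eq_iff, h, Equiv.swap_apply_right]
        exact (Fin.castSucc_lt_last a).ne this
    rw [this, Finset.prod_map]
    rfl
  rw [h1, altKernel_succ (x ∘ τ), h2]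
  have h3 : (x ∘ τ) (Fin.last k) = v j.castSucc := by simp [x, τ]
  rw [h3]
  have h4 : ∀ i, 1 - (x ∘ τ) (Fin.castSucc i) * v j.castSucc ≠ 0 := fun i => h _ _
  have h5 : ∀ i, v j.castSucc - (x ∘ τ) (Fin.castSucc i) ≠ 0 := by
    intro i
    rw [sub_ne_zero, ← h3]
    exact fun hh => (Fin.castSucc_lt_last i).ne
      (((hv.comp (Fin.castSucc_injective _)).comp τ.injective) hh).symm
  have h6 : (∏ i : Fin k, ((v j.castSucc - (x ∘ τ) i.castSucc) /
        (1 - (x ∘ τ) i.castSucc * v j.castSucc))) *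
      ∏ i : Fin k, ((1 - v (τ i.castSucc).castSucc * v j.castSucc) /
        (v j.castSucc - v (τ i.castSucc).castSucc)) = 1 := by
    rw [← Finset.prod_mul_distrib]
    refine Finset.prod_eq_one fun i _ => ?_
    change (_ / (1 - v (τ i.castSucc).castSucc * v j.castSucc)) * (_ / _) = 1
    rw [div_mul_div_comm, mul_comm]
    exact div_self (mul_ne_zero (h4 i) (h5 i))
  have h7 : 1 - v j.castSucc ^ 2 ≠ 0 := by rw [sq]; exact h _ _
  have h8 : (1 - v j.castSucc ^ 2)⁻¹ * (1 - v j.castSucc ^ 2) = 1 := inv_mul_cancel₀ h7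
  have h9 : (x ∘ τ) ∘ Fin.castSucc = x ∘ τ ∘ Fin.castSucc := rfl
  rw [h9]
  generalize (∏ i : Fin k, ((v j.castSucc - (x ∘ τ) i.castSucc) /
        (1 - (x ∘ τ) i.castSucc * v j.castSucc))) = A at *
  generalize (∏ i : Fin k, ((1 - v (τ i.castSucc).castSucc * v j.castSucc) /
        (v j.castSucc - v (τ i.castSucc).castSucc))) = B at *
  generalize (1 - v j.castSucc ^ 2)⁻¹ = D at *
  rw [div_eq_mul_inv]
  set E := altKernel (x ∘ τ ∘ Fin.castSucc)
  change _ = _ * (_ * E)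
  set T := v (Fin.last _) * (1 - v j.castSucc * v (Fin.last _))⁻¹
  linear_combination (((Equiv.Perm.sign τ : ℤ) : K) * E * T) * (D * (1 - v j.castSucc ^ 2)) * h6 +
    (((Equiv.Perm.sign τ : ℤ) : K) * E * T) * h8

end PartialFractions

section Coefficients
open MvPowerSeries

theorem constantCoeff_symDenom {σ : Type*} {k : ℕ} (e : Fin k → σ) :
    constantCoeff (symDenom fun i => (X (e i) : MvPowerSeries σ ℚ)) = 1 := by
  simp [symDenom, map_prod]

theorem symDenom_mul_inv {σ : Type*} {k : ℕ} (e : Fin k → σ) :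
    symDenom (fun i => (X (e i) : MvPowerSeries σ ℚ)) *
      (symDenom fun i => (X (e i) : MvPowerSeries σ ℚ))⁻¹ = 1 :=
  MvPowerSeries.mul_inv_cancel _ (by rw [constantCoeff_symDenom]; exact one_ne_zero)

theorem altKernel_recurrence (k : ℕ) :
    (1 - X (Fin.last _) ^ 2) * altKernel (X : Fin (k + 2) → MvPowerSeries (Fin (k + 2)) ℚ) =
      (∏ i : Fin (k + 1), (-X i.castSucc)) * altKernel (fun i : Fin (k + 1) => X i.castSucc) +
      ∑ j : Fin (k + 1), ((Equiv.Perm.sign (Equiv.swap j (Fin.last k)) : ℤ) :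
          MvPowerSeries (Fin (k + 2)) ℚ) *
        (X (Fin.last _) * (1 - X j.castSucc * X (Fin.last _))⁻¹ *
          altKernel fun i : Fin k => X (Equiv.swap j (Fin.last k) i.castSucc).castSucc) := by
  let A := MvPowerSeries (Fin (k + 2)) ℚ
  let f : A →+* FractionRing A := algebraMap A (FractionRing A)
  have hf : Function.Injective f := IsFractionRing.injective A (FractionRing A)
  have hc : ∀ i j : Fin (k + 2), constantCoeff (1 - X i * X j : A) ≠ 0 := by
    intro i j; simp
  have h0 : ∀ i j : Fin (k + 2), (1 - X i * X j : A) ≠ 0 := by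
    intro i j h; exact hc i j (by rw [h, map_zero])
  have hinv : ∀ i j : Fin (k + 2), f ((1 - X i * X j : A)⁻¹) = (1 - f (X i) * f (X j))⁻¹ := by
    intro i j
    refine eq_inv_of_mul_eq_one_left ?_
    rw [← map_mul, ← map_one f, ← map_sub, ← map_mul, MvPowerSeries.inv_mul_cancel _ (hc i j)]
  have hk : ∀ {m : ℕ} (e : Fin m → Fin (k + 2)),
      f (altKernel fun i => X (e i)) = altKernel fun i => f (X (e i)) := by
    intro m e
    have hd : symDenom (f ∘ fun i => (X (e i) : A)) = f (symDenom fun i => (X (e i) : A)) := by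
      simp [symDenom, map_prod]
    refine map_altKernel f _ (symDenom_mul_inv e) (mul_inv_cancel₀ ?_)
    rw [hd]
    refine (map_ne_zero_iff f hf).2 fun h => ?_
    have := constantCoeff_symDenom e
    rw [h, map_zero] at this
    exact zero_ne_one this
  apply hf
  have key := altKernel_recurrence_field (fun i : Fin (k + 2) => f (X i))
    (fun i j hij => MvPowerSeries.X_inj.1 (hf hij))
    ((map_ne_zero_iff f hf).2 (by
      intro h
      have := congrArg (coeff (Finsupp.single (Fin.last (k + 1)) 1)) h
      simp [coeff_X] at this))
    (fun i j => by
      rw [← map_mul, ← map_one f, ← map_sub]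
      exact (map_ne_zero_iff f hf).2 (h0 i j))
  have hX : f (altKernel X) = altKernel fun i => f (X i) := hk fun i => i
  have hz : ∀ z : ℤ, f ((z : ℤ) : MvPowerSeries (Fin (k + 2)) ℚ) = z := map_intCast f
  simp only [map_mul, map_add, map_sub, map_one, map_pow, map_sum, map_prod, map_neg, hz,
    hinv, hk]
  exact key

/-- The coefficients of `altKernel` at the tuple of all variables. -/
noncomputable def altCoeff {k : ℕ} (b : Fin k → ℕ) : ℚ :=
  coeff (Finsupp.equivFunOnFinite.symm b) (altKernel (X : Fin k → MvPowerSeries (Fin k) ℚ))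

theorem altKernel_rename {k n : ℕ} (e : Fin k ↪ Fin n) :
    altKernel (fun i => (X (e i) : MvPowerSeries (Fin n) ℚ)) = rename e (altKernel X) := by
  have h := map_altKernel (rename (R := ℚ) e).toRingHom (fun i : Fin k => X i)
    (symDenom_mul_inv fun i => i)
    (by
      have : ((rename (R := ℚ) e).toRingHom : _ → _) ∘ (fun i : Fin k => X i) =
          fun i => (X (e i) : MvPowerSeries (Fin n) ℚ) := by
        funext i; exact rename_X e i
      rw [this]
      exact symDenom_mul_inv e)
  refine Eq.trans ?_ h.symm
  congr 1
  funext i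
  exact (rename_X e i).symm

theorem coeff_altKernel_of_supp {k n : ℕ} (e : Fin k ↪ Fin n) (b : Fin n →₀ ℕ)
    (hb : ∀ i ∉ Set.range e, b i = 0) :
    coeff b (altKernel fun i => (X (e i) : MvPowerSeries (Fin n) ℚ)) =
      altCoeff fun i => b (e i) := by
  have : b = Finsupp.embDomain e (Finsupp.equivFunOnFinite.symm fun i => b (e i)) := by
    ext i
    by_cases hi : i ∈ Set.range e
    · obtain ⟨j, rfl⟩ := hi
      rw [Finsupp.embDomain_apply_self]
      rfl
    · rw [hb i hi, Finsupp.embDomain_of_notMem_range _ _ _ hi]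
  rw [altKernel_rename, altCoeff]
  conv_lhs => rw [this]
  rw [coeff_embDomain_rename]

theorem coeff_altKernel_eq_zero {k n : ℕ} (e : Fin k ↪ Fin n) (b : Fin n →₀ ℕ) {i : Fin n}
    (hi : i ∉ Set.range e) (hb : b i ≠ 0) :
    coeff b (altKernel fun i => (X (e i) : MvPowerSeries (Fin n) ℚ)) = 0 := by
  rw [altKernel_rename]
  refine coeff_rename_eq_zero _ _ ?_
  rintro ⟨c, rfl⟩
  exact hb (Finsupp.mapDomain_of_notMem_range _ _ hi)

theorem altCoeff_comp_perm {k : ℕ} (b : Fin k → ℕ) (τ : Equiv.Perm (Fin k)) :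
    altCoeff (b ∘ τ) = (Equiv.Perm.sign τ : ℤ) * altCoeff b := by
  have h := coeff_altKernel_of_supp τ.toEmbedding (Finsupp.equivFunOnFinite.symm b)
    (fun i hi => absurd (τ.surjective i) hi)
  have h2 := altKernel_comp_perm (X : Fin k → MvPowerSeries (Fin k) ℚ) τ
  have h3 : altCoeff (b ∘ τ) =
      coeff (Finsupp.equivFunOnFinite.symm b)
        (altKernel ((X : Fin k → MvPowerSeries (Fin k) ℚ) ∘ τ)) :=
    h.symm
  rw [h3, h2, altCoeff, ← map_intCast (C (σ := Fin k) (R := ℚ)), coeff_C_mul]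

theorem altCoeff_eq_zero_of_eq {k : ℕ} (b : Fin k → ℕ) {i j : Fin k} (hij : i ≠ j)
    (h : b i = b j) : altCoeff b = 0 := by
  have h1 := altCoeff_comp_perm b (Equiv.swap i j)
  have h2 : b ∘ Equiv.swap i j = b := by
    ext x
    rw [Function.comp_apply, Equiv.swap_apply_def]
    split_ifs <;> simp_all
  rw [h2, Equiv.Perm.sign_swap hij] at h1
  simp only [Units.val_neg, Units.val_one, Int.cast_neg, Int.cast_one] at h1
  linarith

theorem coeff_X_mul_geometric {σ : Type*} [DecidableEq σ] {j t : σ} (hjt : j ≠ t)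
    (φ : MvPowerSeries σ ℚ)
    (hφ : ∀ d : σ →₀ ℕ, d j ≠ 0 ∨ d t ≠ 0 → coeff d φ = 0) (b : σ →₀ ℕ) :
    coeff b (X t * (1 - X j * X t)⁻¹ * φ) =
      if b t = b j + 1 then coeff ((b.erase j).erase t) φ else 0 := by
  set H : MvPowerSeries σ ℚ := X t * (1 - X j * X t)⁻¹ * φ with hH
  have hrec : H = X t * φ + X t * (X j * H) := by
    have h1 : (1 - X j * X t : MvPowerSeries σ ℚ) * (1 - X j * X t)⁻¹ = 1 :=
      MvPowerSeries.mul_inv_cancel _ (by simp)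
    rw [hH]
    linear_combination (X t * φ) * h1
  have hX : ∀ (s : σ) (d : σ →₀ ℕ) (ψ : MvPowerSeries σ ℚ),
      coeff d (X s * ψ) = if d s = 0 then 0 else coeff (d - Finsupp.single s 1) ψ := by
    intro s d ψ
    rw [X_def, coeff_monomial_mul, one_mul]
    by_cases h : d s = 0
    · rw [if_pos h, if_neg]
      simpa using h
    · rw [if_neg h, if_pos]
      simpa using Nat.one_le_iff_ne_zero.2 h
  induction hN : b t generalizing b with
  | zero =>
    rw [hrec, map_add, hX, hX, if_pos hN, if_pos hN, if_neg (by omega), add_zero]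
  | succ N ih =>
    rw [hrec, map_add, hX, hX, if_neg (by omega), if_neg (by omega), hX]
    have hbj : (b - Finsupp.single t 1 : σ →₀ ℕ) j = b j := by simp [hjt]
    have hbt : (b - Finsupp.single t 1 : σ →₀ ℕ) t = N := by simp [hN]
    rw [hbj]
    by_cases h0 : b j = 0
    · rw [if_pos h0, add_zero, h0, zero_add]
      by_cases hN0 : N = 0
      · rw [if_pos (by omega)]
        congr 2
        ext x
        rcases eq_or_ne x t with rfl | hxt
        · rw [hbt, hN0, Finsupp.erase_same]
        · rw [Finsupp.erase_ne hxt]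
          rcases eq_or_ne x j with rfl | hxj
          · rw [hbj, h0, Finsupp.erase_same]
          · rw [Finsupp.erase_ne hxj]
            simp [hxt]
      · rw [if_neg (by omega), hφ _ (Or.inr (by rwa [hbt]))]
    · rw [if_neg h0, hφ _ (Or.inl (by rwa [hbj])), zero_add, ih]
      · have e1 : (b - Finsupp.single t 1 - Finsupp.single j 1 : σ →₀ ℕ) j = b j - 1 := by
          simp [hjt]
        rw [e1]
        have e2 : ((b - Finsupp.single t 1 - Finsupp.single j 1 : σ →₀ ℕ).erase j).erase t =
            (b.erase j).erase t := by
          ext x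
          rcases eq_or_ne x t with rfl | hxt
          · simp
          · rw [Finsupp.erase_ne hxt, Finsupp.erase_ne hxt]
            rcases eq_or_ne x j with rfl | hxj
            · simp
            · rw [Finsupp.erase_ne hxj, Finsupp.erase_ne hxj]
              simp [hxt, hxj]
        rw [e2]
        exact if_congr (by omega) rfl rfl
      · simp [hjt.symm, hN]

theorem coeff_X_sq_mul {n : ℕ} (t : Fin n) (b : Fin n → ℕ) (ψ : MvPowerSeries (Fin n) ℚ) :
    coeff (Finsupp.equivFunOnFinite.symm b) (X t ^ 2 * ψ) =
      if 2 ≤ b t then coeff (Finsupp.equivFunOnFinite.symm (Function.update b t (b t - 2))) ψ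
      else 0 := by
  rw [X_pow_eq, coeff_monomial_mul, one_mul]
  refine if_congr (by simp) ?_ rfl
  congr 2
  ext x
  rcases eq_or_ne x t with rfl | hxt
  · simp
  · simp [hxt]

theorem altCoeff_recurrence {k : ℕ} (b : Fin (k + 2) → ℕ) (hb : b (Fin.last _) ≠ 0) :
    altCoeff b =
      (if 2 ≤ b (Fin.last _) then
        altCoeff (Function.update b (Fin.last _) (b (Fin.last _) - 2)) else 0) +
      ∑ j : Fin (k + 1), ((Equiv.Perm.sign (Equiv.swap j (Fin.last k)) : ℤ) : ℚ) *
        if b (Fin.last _) = b j.castSucc + 1 then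
          altCoeff fun i : Fin k => b (Equiv.swap j (Fin.last k) i.castSucc).castSucc else 0 := by
  have h := congrArg (coeff (Finsupp.equivFunOnFinite.symm b)) (altKernel_recurrence k)
  rw [sub_mul, one_mul, map_sub, coeff_X_sq_mul, map_add, map_sum, sub_eq_iff_eq_add] at h
  have h1 : coeff (Finsupp.equivFunOnFinite.symm b) ((∏ i : Fin (k + 1), (-X i.castSucc)) *
      altKernel (fun i : Fin (k + 1) => (X i.castSucc : MvPowerSeries (Fin (k + 2)) ℚ))) = 0 := by
    have hr : (∏ i : Fin (k + 1), (-X i.castSucc)) *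
        altKernel (fun i : Fin (k + 1) => (X i.castSucc : MvPowerSeries (Fin (k + 2)) ℚ)) =
        rename Fin.castSuccEmb ((∏ i : Fin (k + 1), (-X i)) * altKernel X) := by
      rw [map_mul, ← altKernel_rename, map_prod]
      simp
    rw [hr]
    refine coeff_rename_eq_zero _ _ ?_
    rintro ⟨c, hc⟩
    refine hb ?_
    rw [show b (Fin.last _) = Finsupp.equivFunOnFinite.symm b (Fin.last _) from rfl, ← hc]
    exact Finsupp.mapDomain_of_notMem_range _ _ (by simp)
  rw [h1, zero_add] at h
  refine h.trans ((add_comm _ _).trans (congrArg₂ _ rfl ?_))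
  refine Finset.sum_congr rfl fun j _ => ?_
  rw [← map_intCast (C (σ := Fin (k + 2)) (R := ℚ)), coeff_C_mul]
  congr 1
  let τ := Equiv.swap j (Fin.last k)
  let e : Fin k ↪ Fin (k + 2) := (Fin.castSuccEmb.trans τ.toEmbedding).trans Fin.castSuccEmb
  have hej : j.castSucc ∉ Set.range e := by
    rintro ⟨a, ha⟩
    have h3 : τ a.castSucc = j := Fin.castSucc_injective _ ha
    have : a.castSucc = Fin.last k := by
      rw [← τ.injective.eq_iff, h3, Equiv.swap_apply_right]
    exact (Fin.castSucc_lt_last a).ne this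
  have het : Fin.last (k + 1) ∉ Set.range e := by
    rintro ⟨a, ha⟩
    exact (Fin.castSucc_lt_last _).ne ha
  have hjt : j.castSucc ≠ Fin.last (k + 1) := (Fin.castSucc_lt_last _).ne
  refine (coeff_X_mul_geometric hjt _ (fun d hd => hd.elim
    (fun h => coeff_altKernel_eq_zero e d hej h)
    fun h => coeff_altKernel_eq_zero e d het h) _).trans ?_
  refine if_congr Iff.rfl ?_ rfl
  refine (coeff_altKernel_of_supp e _ fun i hi => ?_).trans ?_
  · rcases eq_or_ne i (Fin.last (k + 1)) with rfl | hil
    · simp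
    rw [Finsupp.erase_ne hil]
    rcases eq_or_ne i j.castSucc with rfl | hij
    · simp
    exfalso
    apply hi
    obtain ⟨a, rfl⟩ := Fin.exists_castSucc_eq.2 hil
    obtain ⟨c, hc⟩ := Fin.exists_castSucc_eq.2 (show τ a ≠ Fin.last k from fun h => hij (by
      rw [show a = j by rw [← τ.injective.eq_iff, h, Equiv.swap_apply_left]]))
    refine ⟨c, ?_⟩
    change (τ c.castSucc).castSucc = _
    rw [hc, Equiv.swap_apply_self]
  · congr 1
    ext i
    rw [Finsupp.erase_ne (fun h => het ⟨i, h⟩), Finsupp.erase_ne (fun h => hej ⟨i, h⟩)]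
    rfl

end Coefficients

section StrictlyIncreasing

theorem altCoeff_zero (b : Fin 0 → ℕ) : altCoeff b = 1 := by
  have : Finsupp.equivFunOnFinite.symm b = 0 := by ext i; exact i.elim0
  rw [altCoeff, this, MvPowerSeries.coeff_zero_eq_constantCoeff_apply, altKernel]
  simp [symDenom]

theorem altCoeff_one (b : Fin 1 → ℕ) : altCoeff b = if Even (b 0) then 1 else 0 := by
  have hK : altKernel (MvPowerSeries.X : Fin 1 → MvPowerSeries (Fin 1) ℚ) =
      1 + MvPowerSeries.X 0 ^ 2 * altKernel MvPowerSeries.X := by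
    have hd := symDenom_mul_inv (σ := Fin 1) fun i : Fin 1 => i
    have hs := symDenom_succ (R := MvPowerSeries (Fin 1) ℚ) MvPowerSeries.X
    have h0 : symDenom ((MvPowerSeries.X : Fin 1 → MvPowerSeries (Fin 1) ℚ) ∘ Fin.castSucc) =
        1 := by
      simp [symDenom]
    rw [h0, Fin.prod_univ_zero, one_mul, one_mul] at hs
    have h1 : altKernel (MvPowerSeries.X : Fin 1 → MvPowerSeries (Fin 1) ℚ) =
        (symDenom fun i : Fin 1 => (MvPowerSeries.X i : MvPowerSeries (Fin 1) ℚ))⁻¹ := by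
      simp [altKernel]
    rw [h1]
    change symDenom (fun i : Fin 1 => (MvPowerSeries.X i : MvPowerSeries (Fin 1) ℚ)) = _ at hs
    rw [hs] at hd ⊢
    change (1 - MvPowerSeries.X 0 ^ 2 : MvPowerSeries (Fin 1) ℚ) * _ = 1 at hd
    linear_combination hd
  induction hN : b 0 using Nat.strong_induction_on generalizing b with
  | _ N ih =>
    have hrec : altCoeff b = (if b 0 = 0 then 1 else 0) +
        if 2 ≤ b 0 then altCoeff (Function.update b 0 (b 0 - 2)) else 0 := by
      rw [altCoeff, hK, map_add, coeff_X_sq_mul, MvPowerSeries.coeff_one]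
      refine congrArg₂ _ (if_congr ?_ rfl rfl) rfl
      rw [Finsupp.ext_iff]
      simp
    rw [hrec, hN]
    by_cases h2 : 2 ≤ N
    · rw [if_neg (by omega), if_pos h2, zero_add, ih (N - 2) (by omega) _ (by simp)]
      exact if_congr (by simp [Nat.even_sub h2]) rfl rfl
    · rw [if_neg h2, add_zero]
      refine if_congr ?_ rfl rfl
      rw [Nat.even_iff]
      omega

theorem altCoeff_of_strictMono {k : ℕ} (b : Fin k → ℕ) (hb : StrictMono b) :
    altCoeff b = if ∀ i, b i % 2 = i.val % 2 then 1 else 0 := by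
  induction hN : ∑ i, b i using Nat.strong_induction_on generalizing k b with
  | _ N ih =>
  match k, b, hb, hN with
  | 0, b, _, _ => rw [altCoeff_zero, if_pos fun i => i.elim0]
  | 1, b, _, _ =>
    rw [altCoeff_one]
    exact if_congr (by simp [Nat.even_iff]) rfl rfl
  | k + 2, b, hb, hN =>
  set n := b (Fin.last (k + 1)) with hn
  set m := b (Fin.last k).castSucc with hm
  have hmn : m < n := hb (Fin.castSucc_lt_last _)
  have hlt : ∀ i : Fin k, b i.castSucc.castSucc < m := fun i =>
    hb (Fin.castSucc_lt_castSucc_iff.2 (Fin.castSucc_lt_last i))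
  have hmono2 : StrictMono fun i : Fin k => b i.castSucc.castSucc :=
    hb.comp ((Fin.strictMono_castSucc).comp Fin.strictMono_castSucc)
  have hsum : ∀ c : Fin (k + 2) → ℕ, ∑ i, c i =
      (∑ i : Fin k, c i.castSucc.castSucc) + c (Fin.last k).castSucc + c (Fin.last (k + 1)) := by
    intro c; rw [Fin.sum_univ_castSucc, Fin.sum_univ_castSucc]
  have hrec : altCoeff b = (if 2 ≤ n then
        altCoeff (Function.update b (Fin.last _) (n - 2)) else 0) +
      if n = m + 1 then altCoeff (fun i : Fin k => b i.castSucc.castSucc) else 0 := by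
    rw [altCoeff_recurrence b (by omega), Fin.sum_univ_castSucc, Finset.sum_eq_zero, zero_add]
    · simp [← hn, ← hm]
    · intro j _
      rw [if_neg, mul_zero]
      have := hlt j
      omega
  have hgood : (∀ i : Fin (k + 2), b i % 2 = i.val % 2) ↔
      ((∀ i : Fin k, b i.castSucc.castSucc % 2 = i.val % 2) ∧ m % 2 = k % 2) ∧
        n % 2 = (k + 1) % 2 := by
    rw [Fin.forall_fin_succ', Fin.forall_fin_succ']
    simp [hn, hm]
  have hlast : Fin.last (k + 1) ≠ (Fin.last k).castSucc := (Fin.castSucc_lt_last _).ne'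
  have hne : ∀ i : Fin k, i.castSucc.castSucc ≠ Fin.last (k + 1) :=
    fun i => (Fin.castSucc_lt_last _).ne
  rw [hrec]
  rcases (show n = m + 1 ∨ n = m + 2 ∨ m + 3 ≤ n by omega) with h | h | h
  · rw [if_pos h, ih _ (by rw [← hN, hsum b]; omega) _ hmono2 rfl]
    by_cases hex : ∃ i : Fin k, b i.castSucc.castSucc + 1 = m
    · obtain ⟨i, hi⟩ := hex
      have hik : i.val + 1 = k := by
        by_contra hc
        have hik : i.val + 1 < k := by omega
        have h1 := hlt ⟨i.val + 1, hik⟩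
        have h2 : b i.castSucc.castSucc < b (Fin.castSucc (Fin.castSucc ⟨i.val + 1, hik⟩)) :=
          hmono2 (Fin.lt_def.2 (Nat.lt_succ_self _))
        omega
      rw [altCoeff_eq_zero_of_eq _ (hne i).symm (by
        rw [Function.update_self, Function.update_of_ne (hne i)]; omega), ite_self, zero_add]
      refine if_congr ?_ rfl rfl
      rw [hgood]
      constructor
      · intro hg
        have := hg i
        exact ⟨⟨hg, by omega⟩, by omega⟩
      · exact fun hg => hg.1.1
    · push Not at hex
      by_cases h2 : 2 ≤ n
      · rw [if_pos h2]
        set c : Fin (k + 2) → ℕ := Function.update b (Fin.last _) (n - 2) with hc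
        set τ := Equiv.swap (Fin.last k).castSucc (Fin.last (k + 1)) with hτ
        have hc1 : (c ∘ τ) (Fin.last (k + 1)) = m := by simp [c, τ, hm, hlast.symm]
        have hc2 : (c ∘ τ) (Fin.last k).castSucc = n - 2 := by simp [c, τ]
        have hc3 : ∀ i : Fin k, (c ∘ τ) i.castSucc.castSucc = b i.castSucc.castSucc := by
          intro i
          have : τ i.castSucc.castSucc = i.castSucc.castSucc :=
            Equiv.swap_apply_of_ne_of_ne
              (fun h => (Fin.castSucc_lt_last i).ne (Fin.castSucc_injective _ h)) (hne i)
          rw [Function.comp_apply, this, hc, Function.update_of_ne (hne i)]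
        have hmono : StrictMono (c ∘ τ) := by
          intro i j hij
          induction j using Fin.lastCases with
          | last =>
            obtain ⟨i, rfl⟩ := Fin.exists_castSucc_eq.2 hij.ne
            rw [hc1]
            induction i using Fin.lastCases with
            | last => rw [hc2]; omega
            | cast i => rw [hc3]; exact hlt i
          | cast j =>
            obtain ⟨i, rfl⟩ := Fin.exists_castSucc_eq.2 (hij.trans (Fin.castSucc_lt_last j)).ne
            rw [Fin.castSucc_lt_castSucc_iff] at hij
            induction j using Fin.lastCases with
            | last =>
              obtain ⟨i, rfl⟩ := Fin.exists_castSucc_eq.2 hij.ne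
              rw [hc3, hc2]
              have := hlt i
              have := hex i
              omega
            | cast j =>
              obtain ⟨i, rfl⟩ := Fin.exists_castSucc_eq.2 (hij.trans (Fin.castSucc_lt_last j)).ne
              rw [hc3, hc3]
              exact hmono2 (Fin.castSucc_lt_castSucc_iff.1 hij)
        have h3 := altCoeff_comp_perm c τ
        rw [Equiv.Perm.sign_swap hlast.symm, ih _ (by
          rw [← hN, hsum b, hsum, hc1, hc2]; simp only [hc3]; omega) _ hmono rfl] at h3
        have hgood2 : (∀ i : Fin (k + 2), (c ∘ τ) i % 2 = i.val % 2) ↔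
            ((∀ i : Fin k, b i.castSucc.castSucc % 2 = i.val % 2) ∧ (n - 2) % 2 = k % 2) ∧
              m % 2 = (k + 1) % 2 := by
          rw [Fin.forall_fin_succ', Fin.forall_fin_succ', hc1, hc2]
          simp only [hc3, Fin.val_last, Fin.val_castSucc]
        have h4 : altCoeff c =
            - if (∀ i : Fin (k + 2), (c ∘ τ) i % 2 = i.val % 2) then 1 else 0 := by
          rw [h3]; simp
        rw [h4, if_congr hgood2 rfl rfl, if_congr hgood rfl rfl]
        by_cases hg : ∀ i : Fin k, b i.castSucc.castSucc % 2 = i.val % 2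
        · by_cases hp : m % 2 = k % 2
          · rw [if_neg (by omega), if_pos hg, if_pos ⟨⟨hg, hp⟩, by omega⟩]; simp
          · rw [if_pos ⟨⟨hg, by omega⟩, by omega⟩, if_pos hg, if_neg (by omega)]; simp
        · rw [if_neg fun h => hg h.1.1, if_neg hg, if_neg fun h => hg h.1.1]; simp
      · have hk : k = 0 := by
          by_contra hk
          have := hlt ⟨0, Nat.pos_of_ne_zero hk⟩
          omega
        subst hk
        rw [if_neg h2, zero_add]
        refine if_congr ?_ rfl rfl
        rw [hgood]
        exact ⟨fun hg => ⟨⟨hg, by omega⟩, by omega⟩, fun hg => hg.1.1⟩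
  · rw [if_neg (show ¬ n = m + 1 by omega), add_zero, if_pos (by omega),
      altCoeff_eq_zero_of_eq _ hlast (by
        rw [Function.update_self, Function.update_of_ne hlast.symm]; omega), if_neg]
    rw [hgood]; omega
  · rw [if_neg (show ¬ n = m + 1 by omega), add_zero, if_pos (by omega)]
    set c : Fin (k + 2) → ℕ := Function.update b (Fin.last _) (n - 2) with hc
    have hc1 : c (Fin.last (k + 1)) = n - 2 := Function.update_self ..
    have hc2 : ∀ i : Fin (k + 1), c i.castSucc = b i.castSucc :=
      fun i => Function.update_of_ne (Fin.castSucc_lt_last i).ne _ _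
    have hmono : StrictMono c := by
      intro i j hij
      obtain ⟨i, rfl⟩ := Fin.exists_castSucc_eq.2 (hij.trans_le (Fin.le_last j)).ne
      induction j using Fin.lastCases with
      | last =>
        rw [hc1, hc2]
        have : b i.castSucc ≤ m := hb.monotone (Fin.castSucc_le_castSucc_iff.2 (Fin.le_last i))
        omega
      | cast j => rw [hc2, hc2]; exact hb hij
    rw [ih _ (by rw [← hN, hsum b, hsum, hc1]; simp only [hc2]; omega) c hmono rfl]
    refine if_congr ?_ rfl rfl
    rw [Fin.forall_fin_succ', Fin.forall_fin_succ' (n := k + 1)]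
    simp only [hc1, hc2, ← hn, Fin.val_last, Fin.val_castSucc]
    refine and_congr_right fun _ => ?_
    omega

end StrictlyIncreasing

section PartitionFunction
open MvPowerSeries

open Classical in
theorem coeff_inv_one_sub_monomial {σ : Type*} (w : σ →₀ ℕ) (hw : w ≠ 0) (d : σ →₀ ℕ) :
    coeff d (1 - monomial w 1 : MvPowerSeries σ ℚ)⁻¹ = if ∃ c : ℕ, c • w = d then 1 else 0 := by
  let φ : MvPowerSeries σ ℚ := fun d => if ∃ c : ℕ, c • w = d then 1 else 0
  have hφ : ∀ d, coeff d φ = if ∃ c : ℕ, c • w = d then 1 else 0 := fun d => rfl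
  have h0 : constantCoeff (1 - monomial w 1 : MvPowerSeries σ ℚ) ≠ 0 := by
    rw [map_sub, map_one, ← coeff_zero_eq_constantCoeff_apply, coeff_monomial_ne hw.symm]
    simp
  have h1 : (1 - monomial w 1 : MvPowerSeries σ ℚ)⁻¹ = φ := by
    rw [MvPowerSeries.inv_eq_iff_mul_eq_one h0]
    ext d
    rw [mul_sub, mul_one, map_sub, coeff_mul_monomial, coeff_one, hφ, hφ, mul_one]
    by_cases hd : d = 0
    · subst hd
      rw [if_pos ⟨0, zero_smul _ _⟩, if_neg fun h => hw (nonpos_iff_eq_zero.1 h), if_pos rfl,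
        sub_zero]
    · rw [if_neg hd, sub_eq_zero, ← ite_and]
      refine if_congr ?_ rfl rfl
      constructor
      · rintro ⟨c, rfl⟩
        obtain ⟨c, rfl⟩ := Nat.exists_eq_succ_of_ne_zero (n := c) (by rintro rfl; simp at hd)
        rw [Nat.succ_eq_add_one, add_smul, one_smul]
        exact ⟨le_add_self, c, by rw [add_tsub_cancel_right]⟩
      · rintro ⟨hle, c, hc⟩
        exact ⟨c + 1, by rw [add_smul, one_smul, hc, tsub_add_cancel_of_le hle]⟩
  rw [h1, hφ]

theorem coeff_prod_inv_one_sub_monomial {σ ι : Type*} [Fintype ι] (w : ι → σ →₀ ℕ)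
    (hw : ∀ i, w i ≠ 0) (d : σ →₀ ℕ) :
    coeff d (∏ i, (1 - monomial (w i) 1 : MvPowerSeries σ ℚ)⁻¹) =
      (Set.ncard {c : ι → ℕ | ∑ i, c i • w i = d} : ℚ) := by
  classical
  rw [coeff_prod]
  simp only [coeff_inv_one_sub_monomial _ (hw _), Finset.prod_boole, Finset.mem_univ, true_imp_iff]
  rw [Finset.sum_boole, ← Set.ncard_coe_finset]
  congr 1
  let g : (ι → ℕ) → (ι →₀ σ →₀ ℕ) := fun c => Finsupp.equivFunOnFinite.symm fun i => c i • w i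
  have hg : Function.Injective g := by
    intro c c' h
    funext i
    have h1 : c i • w i = c' i • w i := DFunLike.congr_fun h i
    obtain ⟨x, hx⟩ := Finsupp.ne_iff.1 (hw i)
    have h2 := DFunLike.congr_fun h1 x
    simp only [Finsupp.smul_apply, smul_eq_mul] at h2
    exact Nat.eq_of_mul_eq_mul_right (Nat.pos_of_ne_zero hx) h2
  rw [← Set.ncard_image_of_injective _ hg]
  congr 1
  ext l
  simp only [Finset.coe_filter, Finset.mem_finsuppAntidiag, Set.mem_ofPred_eq, Set.mem_image,
    Finset.subset_univ, and_true]
  constructor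
  · rintro ⟨hl, hc⟩
    choose c hc using hc
    refine ⟨c, ?_, by ext1 i; exact hc i⟩
    rw [← hl]
    exact Finset.sum_congr rfl fun i _ => hc i
  · rintro ⟨c, hc, rfl⟩
    exact ⟨hc, fun i => ⟨c i, rfl⟩⟩

theorem MvPowerSeries.prod_inv {σ ι : Type*} (s : Finset ι) (f : ι → MvPowerSeries σ ℚ) :
    (∏ i ∈ s, f i)⁻¹ = ∏ i ∈ s, (f i)⁻¹ := by
  classical
  induction s using Finset.induction_on with
  | empty =>
    rw [Finset.prod_empty, Finset.prod_empty, MvPowerSeries.inv_eq_iff_mul_eq_one] <;> simp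
  | insert a s ha ih =>
    rw [Finset.prod_insert ha, Finset.prod_insert ha, MvPowerSeries.mul_inv_rev, ih, mul_comm]

theorem coeff_inv_symDenom {n : ℕ} (d : Fin n →₀ ℕ) :
    coeff d (symDenom (X : Fin n → MvPowerSeries (Fin n) ℚ))⁻¹ = Qpart n fun x => d x := by
  have h : ∀ p : {p : Fin n × Fin n // p.1 ≤ p.2},
      (1 - X p.1.1 * X p.1.2 : MvPowerSeries (Fin n) ℚ) =
        1 - monomial (Finsupp.single p.1.1 1 + Finsupp.single p.1.2 1) 1 := by
    intro p
    rw [X_def, X_def, monomial_mul_monomial, one_mul]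
  rw [symDenom, MvPowerSeries.prod_inv]
  simp only [h]
  rw [coeff_prod_inv_one_sub_monomial _ (fun p hp => by
    simpa using DFunLike.congr_fun hp p.1.1), Qpart]
  congr 2
  ext c
  simp only [Set.mem_ofPred_eq, Finsupp.ext_iff]
  refine forall_congr' fun x => ?_
  rw [← Nat.cast_inj (R := ℤ)]
  simp [Finsupp.finsetSum_apply, Finsupp.single_apply, mul_add]

theorem Qpart_eq_zero_of_neg {n : ℕ} (μ : Fin n → ℤ) (x : Fin n) (hx : μ x < 0) :
    Qpart n μ = 0 := by
  have : {c : {p : Fin n × Fin n // p.1 ≤ p.2} → ℕ |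
      ∀ x : Fin n, (∑ p : {p : Fin n × Fin n // p.1 ≤ p.2},
        (c p : ℤ) * ((if p.1.1 = x then 1 else 0) + (if p.1.2 = x then 1 else 0))) = μ x} = ∅ := by
    refine Set.eq_empty_of_forall_notMem fun c hc => ?_
    have h := hc x
    have : (0 : ℤ) ≤ ∑ p : {p : Fin n × Fin n // p.1 ≤ p.2},
        (c p : ℤ) * ((if p.1.1 = x then 1 else 0) + (if p.1.2 = x then 1 else 0)) :=
      Finset.sum_nonneg fun p _ => by positivity
    omega
  rw [Qpart, this, Set.ncard_empty]

theorem altCoeff_eq_sum_Qpart {n : ℕ} (b : Fin n → ℕ) :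
    altCoeff b = ∑ σ : Equiv.Perm (Fin n),
      ((Equiv.Perm.sign σ : ℤ) : ℚ) * Qpart n fun x => (b x : ℤ) - ((σ⁻¹ x : Fin n) : ℕ) := by
  rw [altCoeff, altKernel, Matrix.det_apply', Finset.sum_mul, map_sum]
  refine Finset.sum_congr rfl fun σ _ => ?_
  have hm : ∏ i, Matrix.vandermonde (X : Fin n → MvPowerSeries (Fin n) ℚ) (σ i) i =
      monomial (Finsupp.equivFunOnFinite.symm fun x => ((σ⁻¹ x : Fin n) : ℕ)) 1 := by
    have h1 : (Finsupp.equivFunOnFinite.symm fun x => ((σ⁻¹ x : Fin n) : ℕ)) =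
        ∑ i, Finsupp.single (σ i) (i : ℕ) := by
      ext x
      rw [Finsupp.finsetSum_apply, ← Equiv.sum_comp σ⁻¹]
      simp [Finsupp.single_apply]
    have h2 : ∀ s : Finset (Fin n),
        (monomial (∑ i ∈ s, Finsupp.single (σ i) (i : ℕ)) 1 : MvPowerSeries (Fin n) ℚ) =
          ∏ i ∈ s, X (σ i) ^ (i : ℕ) := by
      intro s
      induction s using Finset.induction_on with
      | empty => simp
      | insert a s ha ih =>
        rw [Finset.sum_insert ha, Finset.prod_insert ha, ← ih, X_pow_eq, monomial_mul_monomial,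
          one_mul]
    rw [h1, h2]
    rfl
  rw [hm, mul_assoc, ← map_intCast (C (σ := Fin n) (R := ℚ)), coeff_C_mul, coeff_monomial_mul,
    one_mul, coeff_inv_symDenom]
  congr 1
  split_ifs with h
  · congr 2
    funext x
    have := h x
    simp only [Finsupp.equivFunOnFinite_symm_apply_apply] at this
    exact Nat.cast_sub this
  · have : ∃ x, b x < ((σ⁻¹ x : Fin n) : ℕ) := by
      by_contra hc
      push Not at hc
      exact h fun x => hc x
    obtain ⟨x, hx⟩ := this
    rw [Qpart_eq_zero_of_neg _ x (sub_neg.2 (by exact_mod_cast hx)), Nat.cast_zero]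

end PartitionFunction

/-- The Blattner-type multiplicity computation (Lemma 5.3 of the paper): for
`ℓ₁ > ⋯ > ℓₙ > 0` with `ℓⱼ - ℓⱼ₋₁` odd, and `m ≥ 0` even, the alternating sum
`∑_{σ ∈ Sₙ} ε(σ) Q(∑ⱼ (ℓ₁+1+m-ℓⱼ)eⱼ - σ(∑ⱼ j eⱼ))` equals `1`. -/
theorem stmt_15 (n : ℕ) (hn : 0 < n) (ℓ : Fin n → ℤ)
    (hanti : ∀ i j : Fin n, i < j → ℓ j < ℓ i) (hpos : ∀ i, 0 < ℓ i)
    (hodd : ∀ i : Fin n, ∀ hi : i.1 + 1 < n, Odd (ℓ ⟨i.1 + 1, hi⟩ - ℓ i))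
    (m : ℕ) (hm : Even m) :
    (∑ σ : Equiv.Perm (Fin n),
        ((Equiv.Perm.sign σ : ℤˣ) : ℤ) *
          (Qpart n (fun x =>
            (ℓ ⟨0, hn⟩ + 1 + (m : ℤ) - ℓ x) - (((σ⁻¹ x : Fin n) : ℕ) + 1)) : ℤ)) = 1 := by
  let b : Fin n → ℕ := fun x => (ℓ ⟨0, hn⟩ + m - ℓ x).toNat
  have hle : ∀ x, ℓ x ≤ ℓ ⟨0, hn⟩ := by
    intro x
    rcases (Fin.le_def.2 (Nat.zero_le _) : (⟨0, hn⟩ : Fin n) ≤ x).eq_or_lt with h | h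
    · rw [h]
    · exact (hanti _ _ h).le
  have hb : ∀ x, (b x : ℤ) = ℓ ⟨0, hn⟩ + m - ℓ x := fun x =>
    Int.toNat_of_nonneg (by have := hle x; omega)
  have hmono : StrictMono b := by
    intro i j hij
    have h1 := hb i
    have h2 := hb j
    have h3 := hanti i j hij
    omega
  have hpar : ∀ i : ℕ, ∀ hi : i < n, b ⟨i, hi⟩ % 2 = i % 2 := by
    intro i
    induction i with
    | zero =>
      intro hi
      have h1 := hb ⟨0, hi⟩
      obtain ⟨r, hr⟩ := hm
      omega
    | succ i ih =>
      intro hi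
      have h1 := hb ⟨i, by omega⟩
      have h2 := hb ⟨i + 1, hi⟩
      have h3 := ih (by omega)
      obtain ⟨r, hr⟩ := hodd ⟨i, by omega⟩ hi
      simp only at hr
      omega
  have key := altCoeff_eq_sum_Qpart b
  have hpar' : ∀ i : Fin n, b i % 2 = i % 2 := fun i => hpar i.1 i.2
  rw [altCoeff_of_strictMono b hmono, if_pos hpar'] at key
  have hf : ∀ σ : Equiv.Perm (Fin n), (fun x => (b x : ℤ) - ((σ⁻¹ x : Fin n) : ℕ)) =
      fun x => (ℓ ⟨0, hn⟩ + 1 + (m : ℤ) - ℓ x) - (((σ⁻¹ x : Fin n) : ℕ) + 1) := by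
    intro σ
    funext x
    rw [hb]
    ring
  simp only [hf] at key
  exact_mod_cast key.symm
end
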